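/- arXiv:2311.12466 — 2 statements merged into one kernel-verified Lean document; each statement's English description precedes it below -/
import Mathlib

section
/- Let V be a type and let l be a nonempty list of directed edges in V × V that forms a closed chain: consecutive edges satisfy e.2 = e'.1 (the second component of each edge equals the first component of the next), and the second component of the last edge equals the first component of the first edge. Suppose some vertex occurs as the first component of edges at two distinct positions of l. Then there exist lists r, m, g with l = r ++ m ++ g such that: m is a nonempty closed chain; r ++ g is a nonempty closed chain; every edge of l belongs to exactly one of m and r ++ g (the concatenation (r ++ g) ++ m is a permutation of l); the lengths satisfy |m| + |r ++ g| = |l|; and both |m| < |l| and |r ++ g| < |l|. -/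
/-- A nonempty list of directed edges forming a closed chain: consecutive edges
match up (`e.2 = e'.1`) and the last edge's endpoint is the first edge's start. -/
def IsClosedChain {V : Type*} (l : List (V × V)) : Prop :=
  l ≠ [] ∧ l.Chain' (fun e e' => e.2 = e'.1) ∧
    ∀ h : l ≠ [], (l.getLast h).2 = (l.head h).1

/-- Cutting a closed chain at two edges with the same start gives two closed chains. -/
theorem IsClosedChain.split {V : Type*} {r m g : List (V × V)} {b c : V × V}
    (h : IsClosedChain (r ++ b :: m ++ c :: g)) (hbc : b.1 = c.1) :
    IsClosedChain (b :: m) ∧ IsClosedChain (r ++ c :: g) := by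
  obtain ⟨-, hchain, hclose⟩ := h
  replace hclose := hclose (by simp)
  obtain ⟨hrm, hg, hmg⟩ := List.isChain_append.1 hchain
  obtain ⟨hr, hm, hrb⟩ := List.isChain_append.1 hrm
  refine ⟨⟨by simp, hm, fun hne => ?_⟩, by simp, List.isChain_append.2 ⟨hr, hg, ?_⟩, fun hne => ?_⟩
  · have hlast := hmg ((b :: m).getLast hne) (by simp [List.getLast?_eq_some_getLast]) c (by simp)
    simpa [hbc] using hlast
  · intro x hx y hy
    have hxb := hrb x hx b (by simp)
    simp only [List.head?_cons, Option.mem_def, Option.some.injEq] at hy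
    rw [hxb, hbc, hy]
  · cases r <;> simp_all

/-- A closed chain in which some vertex occurs as the first component of edges
at two distinct positions splits as `l = r ++ m ++ g` where `m` and `r ++ g`
are nonempty closed chains, `(r ++ g) ++ m` is a permutation of `l`, the
lengths add up, and both parts are strictly shorter than `l`. -/
theorem stmt_8 {V : Type*} (l : List (V × V)) (hl : IsClosedChain l)
    (hrep : ∃ (i j : ℕ) (hi : i < l.length) (hj : j < l.length),
      i ≠ j ∧ (l.get ⟨i, hi⟩).1 = (l.get ⟨j, hj⟩).1) :
    ∃ r m g : List (V × V), l = r ++ m ++ g ∧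
      IsClosedChain m ∧ IsClosedChain (r ++ g) ∧
      ((r ++ g) ++ m).Perm l ∧
      m.length + (r ++ g).length = l.length ∧
      m.length < l.length ∧ (r ++ g).length < l.length := by
  obtain ⟨i, j, hi, hj, hij, heq⟩ := hrep
  wlog hlt : i < j generalizing i j
  · exact this j i hj hi hij.symm heq.symm (by omega)
  have hdecomp : l = l.take i ++ l[i] :: (l.take j).drop (i + 1) ++ l[j] :: l.drop (j + 1) := by
    have hi' : i < (l.take j).length := by simp; omega
    have htake := List.take_append_drop i (l.take j)
    rw [List.drop_eq_getElem_cons hi', List.take_take, min_eq_left hlt.le,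
      List.getElem_take] at htake
    rw [htake, ← List.drop_eq_getElem_cons hj, List.take_append_drop]
  change l[i].1 = l[j].1 at heq
  obtain ⟨hm, hrg⟩ := IsClosedChain.split (hdecomp ▸ hl) heq
  have hperm : ((l.take i ++ l[j] :: l.drop (j + 1)) ++
      l[i] :: (l.take j).drop (i + 1)).Perm l := by
    conv_rhs => rw [hdecomp]
    rw [List.append_assoc, List.append_assoc]
    exact List.perm_append_comm.append_left _
  have hlen := hperm.length_eq
  rw [List.length_append] at hlen
  have hm_pos := List.length_pos_iff.2 hm.1
  have hrg_pos := List.length_pos_iff.2 hrg.1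
  exact ⟨_, _, _, hdecomp, hm, hrg, hperm, by omega, by omega, by omega⟩
end

section
/- Let G be a simple graph, u a vertex, and w a closed walk from u to u that is a trail (no repeated edges), is not the empty walk, and is not a cycle. Then there exist a vertex x, a closed trail w₁ from u to u, and a closed trail w₂ from x to x, such that w₁ and w₂ both have positive length, the list of edges of w is a permutation of the concatenation of the edge lists of w₁ and w₂, and the lengths satisfy length(w₁) + length(w₂) = length(w) (hence both are strictly shorter than w). -/
/-- A walk that is not a path contains a nonempty closed subwalk. -/
theorem SimpleGraph.Walk.exists_eq_append_closed_append_of_not_isPath {V : Type*}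
    {G : SimpleGraph V} {a b : V} (p : G.Walk a b) (hp : ¬ p.IsPath) :
    ∃ (x : V) (q : G.Walk a x) (c : G.Walk x x) (r : G.Walk x b),
      0 < c.length ∧ p = q.append (c.append r) := by
  classical
  induction p with
  | nil => simp at hp
  | @cons a _ _ h p ih =>
    by_cases ha : a ∈ p.support
    · exact ⟨a, .nil, .cons h (p.takeUntil a ha), p.dropUntil a ha, by simp, by simp⟩
    · obtain ⟨x, q, c, r, hc, rfl⟩ := ih fun hp' => hp (hp'.cons ha)
      exact ⟨x, .cons h q, c, r, hc, by simp⟩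

/-- A closed trail that is neither empty nor a cycle decomposes into two
strictly shorter closed trails whose edge lists partition its edges. -/
theorem stmt_9 {V : Type*} (G : SimpleGraph V) (u : V) (w : G.Walk u u)
    (htrail : w.IsTrail) (hne : w ≠ SimpleGraph.Walk.nil) (hnc : ¬ w.IsCycle) :
    ∃ (x : V) (w₁ : G.Walk u u) (w₂ : G.Walk x x),
      w₁.IsTrail ∧ w₂.IsTrail ∧ 0 < w₁.length ∧ 0 < w₂.length ∧
      (w₁.edges ++ w₂.edges).Perm w.edges ∧
      w₁.length + w₂.length = w.length := by
  cases w with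
  | nil => exact absurd rfl hne
  | cons h p =>
    have hp : ¬ p.IsPath := fun hp => hnc <| by
      rw [SimpleGraph.Walk.isCycle_def]
      exact ⟨htrail, hne, by simpa using hp.support_nodup⟩
    obtain ⟨x, q, c, r, hc, rfl⟩ := p.exists_eq_append_closed_append_of_not_isPath hp
    have hperm : ((SimpleGraph.Walk.cons h (q.append r)).edges ++ c.edges).Perm
        (SimpleGraph.Walk.cons h (q.append (c.append r))).edges := by
      simp only [SimpleGraph.Walk.edges_cons, SimpleGraph.Walk.edges_append, List.cons_append,
        List.append_assoc]
      exact (List.perm_append_comm.append_left _).cons _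
    have hnodup := hperm.nodup_iff.mpr htrail.edges_nodup
    refine ⟨x, .cons h (q.append r), c, ⟨hnodup.of_append_left⟩, ⟨hnodup.of_append_right⟩,
      by simp, hc, hperm, ?_⟩
    simp only [SimpleGraph.Walk.length_cons, SimpleGraph.Walk.length_append]
    omega
end
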